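/- For every natural number n ≥ 1, the supremum of the growth factor over all rook pivoted real n×n matrices satisfies g[RP_n(ℝ)] > (1/641)·n^{1.669}. -/

import Mathlib

open scoped BigOperators

/-- `geIter A k` is the Gaussian elimination iterate `A^{(k+1)}` (0-indexed, `geIter A 0 = A`).
Entries with row or column index `< k` are left unchanged; they are irrelevant. -/
noncomputable def geIter {𝕜 : Type*} [Field 𝕜] {n : ℕ} (A : Matrix (Fin n) (Fin n) 𝕜) :
    ℕ → Matrix (Fin n) (Fin n) 𝕜
  | 0 => A
  | k + 1 => fun i j =>
    if h : k < n ∧ k + 1 ≤ i.1 ∧ k + 1 ≤ j.1 then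
      geIter A k i j -
        geIter A k i ⟨k, h.1⟩ * geIter A k ⟨k, h.1⟩ j / geIter A k ⟨k, h.1⟩ ⟨k, h.1⟩
    else geIter A k i j

/-- The norm of the pivot `a^{(k+1)}_{k,k}` (0-indexed). -/
noncomputable def pivotNorm {𝕜 : Type*} [RCLike 𝕜] {n : ℕ}
    (A : Matrix (Fin n) (Fin n) 𝕜) (k : ℕ) : ℝ :=
  if h : k < n then ‖geIter A k ⟨k, h⟩ ⟨k, h⟩‖ else 0

/-- The growth factor `g(A)`. -/
noncomputable def growth {𝕜 : Type*} [RCLike 𝕜] {n : ℕ} (A : Matrix (Fin n) (Fin n) 𝕜) : ℝ :=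
  (⨆ k : Fin n, ⨆ i : Fin n, ⨆ j : Fin n,
      if k.1 ≤ i.1 ∧ k.1 ≤ j.1 then ‖geIter A k.1 i j‖ else 0) /
    ⨆ i : Fin n, ⨆ j : Fin n, ‖A i j‖

/-- `A` is rook pivoted: `A ∈ RP_n(𝕜)`. -/
def IsRP {𝕜 : Type*} [RCLike 𝕜] {n : ℕ} (A : Matrix (Fin n) (Fin n) 𝕜) : Prop :=
  A.det ≠ 0 ∧ (∀ k : ℕ, k + 1 < n → pivotNorm A k ≠ 0) ∧
    ∀ (k : ℕ) (hk : k < n) (i : Fin n), k ≤ i.1 →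
      ‖geIter A k i ⟨k, hk⟩‖ ≤ pivotNorm A k ∧ ‖geIter A k ⟨k, hk⟩ i‖ ≤ pivotNorm A k

/-- `g[RP_n(𝕜)]`. -/
noncomputable def gRP (𝕜 : Type*) [RCLike 𝕜] (n : ℕ) : ℝ :=
  sSup (growth '' {A : Matrix (Fin n) (Fin n) 𝕜 | IsRP A})

set_option maxHeartbeats 4000000 in
/-- Rows of `10^4 * L` (lower triangular part). -/
def rowsL : List (List ℤ) := [
  [10000],
  [0, 10000],
  [0, 0, 10000],
  [1, 0, -1, 10000],
  [-5, 0, -11, 14, 10000],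
  [-1, 0, 63, -64, 1, 10000],
  [86, 21, -67, 72, -40, -75, 10000],
  [17, -5, -1, 17, -5, -2, 8, 10000],
  [-3, -11, -40, 25, -12, 22, -35, -4, 10000],
  [-361, 231, -272, -225, 764, 459, -140, -616, -92, 10000],
  [7749, 7012, -2442, 4189, -2944, -6390, -3852, 8856, 10000, 6736, 10000],
  [-9310, -4911, 7261, -7629, 10000, 6296, 7128, -5394, -9676, -10000, -8229, 10000],
  [-8905, -2893, 9965, -10000, 8372, 9625, 9347, -10000, -9823, -10000, -9616, 10000, 10000],
  [405, -4957, 8654, -7872, -5934, 7468, 4799, -3718, -8361, -10000, -5305, 4640, 4501, 10000],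
  [9826, 10000, -4837, 8625, -1817, -5285, -6870, 8683, 9833, 9986, 8776, -4035, -3175, -265, 10000],
  [252, -1825, -456, -3132, 2084, -2966, 10000, 268, -8201, -5768, -2146, 2420, 1423, 1021, -171, 10000],
  [6905, 8659, 5738, -8696, -10000, -2063, 10000, -9985, 4344, -3169, 3564, 3204, 9981, 5014, 3998, 3813, 10000],
  [-10000, -9616, 2174, -6744, 4871, 9680, 903, -3862, -8138, -7110, -7910, 786, -2751, -1575, -7924, -4679, -2804, 10000],
  [6849, -8637, -6202, -2789, -9999, -5447, -9406, 9707, 9967, -2532, 4906, -6222, -1898, 3056, -9999, -7750, -4860, 4563, 10000],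
  [9903, 9468, 9437, 1696, -9989, 9927, -9863, 10000, 10000, -10000, 9512, -1723, -3213, -3311, -1009, -8605, 1665, -703, -361, 10000],
  [-9310, 5362, -10000, 10000, -9871, 10000, -9683, 5839, -5952, -8784, -7250, -8231, -9990, 10000, 6603, 2680, -3098, 8717, -10000, -2025, 10000],
  [-9782, -8743, -1692, -10000, -5790, 9991, 3918, 9882, 10000, -10000, -56, -1632, -10000, 10000, 3933, 2037, 66, 9245, -5397, -2081, 7599, 10000],
  [-3723, -10000, 4721, -10000, 10000, -10000, 9903, 5431, 10000, 9010, 6964, -618, -8840, -2769, 10000, 7713, 2119, -3480, -3158, -1657, -243, 7108, 10000],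
  [8094, -9935, 2804, -10000, -8335, -9747, -10000, 9992, -10000, 9637, 10000, 10000, -8929, 8766, 3853, 8312, -5999, 10000, 10000, -10000, -6370, -1101, -5084, 10000],
  [-8968, 10000, -9999, -10000, 9937, -9066, -8948, -9860, 8391, -9222, -9993, 3193, -1619, -8986, -6729, -6795, -9627, 10000, 6898, -3236, -4120, -10000, 2557, 3423, 10000],
  [10000, 10000, 9995, -497, 10000, -9996, -9997, 9998, -9973, -10000, 4012, -220, -10000, -9013, -3705, 5457, -5565, -6278, 4135, 6630, -6809, -9833, 4182, 2180, 2648, 10000],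
  [10000, -9573, 9567, 7369, 10000, -5333, -10000, -9589, -10000, -10000, -5065, -9997, 10000, 10000, -10000, 9939, 10000, 10000, 3651, 1684, 6061, 10000, -4051, -4508, -3411, -2, 10000],
  [9435, 10000, 8872, -9973, -9999, 10000, -10000, -9999, -5714, 9798, -10000, -168, -10000, 296, 10000, 10000, -9888, -10000, -10000, -4029, -10000, 10000, 9879, 10000, 6441, -7195, 4593, 10000],
  [-10000, -10000, -10000, 10000, -8109, -9947, 5633, -10000, -10000, -9395, 10000, 9860, 8282, 10000, 8430, -2885, -10000, -766, -7326, 10000, 7780, 367, 10000, 3090, 6737, -10000, -7548, -715, 10000],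
  [-10000, 10000, -9991, -9998, -9934, -10000, 9521, 10000, -10000, 141, -2342, -4944, -10000, 10000, 8491, -10000, 10000, -10000, 10000, 10000, -9997, 7355, -9848, 10000, 10000, -10000, 721, 2743, 9849, 10000],
  [10000, 10000, 10000, -6001, 10000, -9998, 10000, -10000, 9790, -10000, 10000, -10000, -10000, 9489, 10000, -10000, 3854, 10000, -9065, -10000, -6101, -10000, -10000, 9701, -9961, -10000, -10000, -1102, 3648, 1807, 10000],
  [10000, 9996, -10000, 9993, -6887, 10000, 10000, -10000, -10000, 10000, 10000, 10000, -10000, 9994, -10000, -10000, 10000, -9993, -10000, -10000, 10000, -9778, 10000, 10000, 10000, 4986, 10000, -10000, 4697, 3877, -3894, 10000],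
  [10000, -10000, -10000, -10000, 9999, -3817, -9910, 10000, -10000, 9871, -10000, 2086, 9880, 1218, 10000, -10000, 10000, 10000, -3216, 9922, -10000, -9997, 10000, -10000, 10000, 663, -10000, 2550, -2278, -1989, -4219, -6244, 10000],
  [-10000, 10000, 10000, 10000, 10000, 10000, 8728, 10000, -9630, 10000, -10000, 10000, -10000, 10000, -10000, 10000, 10000, 8600, 10000, 2052, -9998, -10000, 10000, -10000, -1721, -10000, -10000, -164, -10000, 4134, -9999, -7911, -10000, 10000],
  [10000, 1139, -10000, -9960, -9998, 10000, 10000, 9999, -10000, -10000, 10000, -10000, -9995, -10000, 10000, 649, 10000, -9998, 10000, -10000, 9973, -10000, 10000, -10000, 9567, -10000, 10000, 10000, 10000, -10000, 304, -10000, -10000, 1226, 10000],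
  [6541, 10000, -10000, -10000, 10000, 10000, 4863, 10000, 10000, -10000, -10000, -10000, -10000, 10000, -10000, -10000, 10000, -10000, -10000, -10000, -10000, -10000, 10000, 10000, -10000, -10000, 10000, -10000, 10000, -10000, -10000, -10000, -10000, -10000, -10000, 10000]]

set_option maxHeartbeats 4000000 in
/-- Columns of `10^4 * U` (upper triangular part). -/
def colsU : List (List ℤ) := [
  [10000],
  [-1, 10000],
  [0, 0, 10000],
  [1, -1, 0, 10000],
  [0, 0, -1, 0, 10000],
  [-3, -3, 2, -4, 1, 10000],
  [156, -257, 270, 158, 42, 169, 10000],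
  [2, -4, 5, 1, -3, -2, 4, 10000],
  [44, 26, -19, -83, -30, -41, -18, -99, 10000],
  [239, -142, 313, -105, -37, -140, 323, 104, 161, 10000],
  [-9954, 2973, -2083, -7041, 10000, 8207, -8865, -3740, -3408, 408, 10000],
  [9998, 112, -2613, 4132, -1739, -3724, 3368, 5549, 5362, -7856, -4070, 10000],
  [-10000, 9248, -127, -9286, 5336, 9652, -5038, 3121, -4736, 7616, 8088, -5349, 10000],
  [-10000, 9950, -1116, -8978, 8985, 9805, -9250, 2138, -4430, 4106, 8818, -2666, 7493, 10000],
  [9997, -7024, -896, 9968, -1891, -721, 6365, 162, 6829, -6287, -6203, 4017, -3468, -2144, 10000],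
  [-5066, 8752, -9691, -9982, 7735, 6420, -6599, -527, 582, 1012, 5754, -2351, 3455, 3285, -1626, 10000],
  [-2510, -9999, -39, 9855, -9997, -8072, -9850, -8472, 9337, -8820, -5909, 9110, -10000, -8201, 5006, 376, 10000],
  [5619, 4180, -3441, -1297, -4344, 1423, 9908, 4059, -1747, 1975, -807, -1995, 1368, -3097, -1279, 814, -1846, 10000],
  [4327, -4480, -4377, 6805, 9983, 10000, -4449, -9778, 6315, -2000, -1288, 1785, -1019, 9060, 10000, -974, -2471, -6444, 10000],
  [9167, 2225, -10000, -9998, 8116, 9993, 8303, -9994, 1851, 6438, 4184, -5594, -4282, 4399, -3679, 5354, -3811, 5063, 1797, 10000],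
  [10000, 9999, 10000, -9483, 10000, -10000, 5007, 10000, 201, 10000, -9922, 55, -1046, 7767, 2192, -6507, -5195, -4061, 4358, 1458, 10000],
  [10000, 9414, -9947, 9384, 6802, 6165, 8003, 9050, -10000, -10000, 3228, 6762, 2739, -8383, 29, -4816, -694, 8554, -337, -4928, -3831, 10000],
  [-9990, 9867, 9592, 9981, -10000, -9980, 1908, 9997, -9930, -8248, 3219, -2930, 10000, -10000, -3162, -10000, 2378, 9672, -939, -9836, -4418, 7238, 10000],
  [2339, -9922, 9915, 10000, 561, 9861, 10000, 9964, 10000, 10000, -9991, -10000, 10000, -10000, 9999, 9457, 4107, 9980, 9705, 10000, 8284, -7497, 5461, 10000],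
  [-10000, -9991, 10000, 10000, 9926, 9999, 1594, 10000, 9956, -10000, 9523, -9999, 9950, 10000, -9958, 9800, -2185, -8183, -9981, -9319, -8678, -2224, -10000, -2104, 10000],
  [-10000, 7822, -9977, 9974, -2313, 10000, 9984, -10000, -10000, -10000, 9872, -9995, 2999, 7941, 10000, -9508, -2156, 6389, 5761, -6813, -10000, 6819, 9993, -1826, -1311, 10000],
  [-10000, -9564, 7289, 3286, -10000, -10000, 10000, -10000, 10000, 7979, 4915, 10000, -9999, 10000, 9621, -4929, -10000, 10000, -10000, 10000, -9940, -9870, -9996, -7789, -565, -2195, 10000],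
  [-10000, -1956, -10000, 10000, 9802, -9855, 8784, 9991, 9985, 10000, -5996, 10000, 6573, 10000, -10000, -10000, 10000, 7627, 1395, 10000, 9318, -9953, 9979, 10000, -10000, 8997, 1885, 10000],
  [10000, 10000, 9999, 10000, -9999, 10000, -10000, -10000, 9935, 10000, -9785, 10000, -10000, -5646, -10000, 10000, 3389, 9995, 2922, -10000, -6123, 9563, -1060, -6834, 73, 10000, -6076, -1041, 10000],
  [9994, -10000, -10000, -10000, -9990, 10000, -10000, 10000, 9897, -8959, -952, 7876, 9970, -10000, 10000, 9397, -9986, 10000, -9484, -10000, -8724, -10000, 10000, -10000, -10000, 891, 6408, 606, 6083, 10000],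
  [-9999, 10000, -10000, 10000, -10000, 10000, -10000, 10000, -9999, 10000, -10000, 10000, -10000, 10000, -10000, 10000, 10000, -10000, 10000, 10000, -10000, 9945, 10000, -2635, 9421, -10000, 815, -10000, -4151, -6647, 10000],
  [-10000, 9977, 10000, -10000, 10000, -9997, -9774, 10000, 10000, -10000, -10000, -10000, -10000, 2634, 7478, 10000, 10000, 10000, 10000, -3205, -10000, -7519, -10000, -10000, -10000, -10000, -10000, 9999, 9826, -10000, -10000, 10000],
  [-10000, 10000, 10000, 9976, -10000, 10000, 10000, -10000, 10000, -10000, 10000, 7773, -10000, -10000, -9897, 10000, -9999, -9999, 10000, -10000, 10000, -9159, 9926, 926, -10000, -10000, 8676, -934, 398, 7614, -711, -4242, 10000],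
  [-9595, 10000, -9999, -10000, -10000, -9995, 8239, 4689, 10000, -9199, -10000, -10000, 10000, -10000, 9998, -10000, -10000, -10000, -10000, 358, -10000, 10000, -10000, 10000, -10000, 10000, 10000, -8336, 10000, -10000, -1913, -2218, 7965, 10000],
  [6488, 10000, 9991, 10000, 10000, -9999, -10000, -10000, 10000, -10000, -10000, -10000, 9566, 10000, -10000, 10000, -10000, 7667, -10000, 10000, -10000, 10000, 10000, 10000, -10000, -10000, -10000, -10000, -10000, 9998, -10000, -552, -2019, -10000, 10000],
  [-10000, -10000, 10000, 10000, -10000, -10000, -10000, -10000, -10000, 10000, 10000, 10000, 10000, -10000, 10000, 10000, -10000, 10000, 10000, 10000, 10000, 10000, -10000, -10000, 10000, 10000, -10000, 10000, -10000, 10000, 10000, 10000, 10000, 10000, 10000, 10000]]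

/-- `10^3 * d`. -/
def pivD : List ℤ := [982, 982, 982, 982, 982, 982, 983, 982, 983, 987, 2153, 1871, 1753, 1596, 1398, 1813, 3172, 1697, 2846, 3057, 4589, 3934, 3301, 8984, 7714, 5425, 11214, 19901, 18181, 24673, 31474, 58054, 30370, 80437, 112932, 452504]

/-- `Σ_k r_k d_k c_k`, truncated at the shortest list. -/
def dot3 : List ℤ → List ℤ → List ℤ → ℤ
  | a :: r, b :: d, c :: s => a * b * c + dot3 r d s
  | _, _, _ => 0

theorem dot3_eq (m : ℕ) : ∀ (r d s : List ℤ), d.length = m →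
    dot3 r d s = ∑ k ∈ Finset.range m, r.getD k 0 * d.getD k 0 * s.getD k 0 := by
  induction m with
  | zero =>
    intro r d s h
    have : d = [] := List.length_eq_zero_iff.mp h
    subst this
    cases r <;> simp [dot3]
  | succ m ih =>
    intro r d s h
    cases d with
    | nil => simp at h
    | cons b d =>
      have hd : d.length = m := by simpa using h
      rw [Finset.sum_range_succ']
      cases r with
      | nil => simp [dot3]
      | cons a r =>
        cases s with
        | nil => simp [dot3]
        | cons c s =>
          simp only [dot3, List.getD_cons_succ, List.getD_cons_zero]
          rw [ih r d s hd]; ring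

/-- There is a bounded `L D U` product of size `n` with a pivot at least `c`. -/
def Good (n : ℕ) (c : ℝ) : Prop :=
  ∃ (L U : Fin n → Fin n → ℝ) (d : Fin n → ℝ),
    (∀ i, L i i = 1) ∧ (∀ i j, i < j → L i j = 0) ∧ (∀ i j, |L i j| ≤ 1) ∧
    (∀ i, U i i = 1) ∧ (∀ i j, j < i → U i j = 0) ∧ (∀ i j, |U i j| ≤ 1) ∧
    (∀ k, 0 < d k) ∧ (∀ i j, |∑ k, L i k * d k * U k j| ≤ 1) ∧ ∃ k, c ≤ d k

theorem good_one : Good 1 1 :=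
  ⟨fun _ _ => 1, fun _ _ => 1, fun _ => 1, by simp, by intro i j h; omega, by simp, by simp,
    by intro i j h; omega, by simp, by simp, by simp, 0, le_rfl⟩

theorem good_succ {n : ℕ} {c : ℝ} (h : Good n c) : Good (n + 1) c := by
  obtain ⟨L, U, d, h1, h2, h3, h4, h5, h6, h7, h8, k, hk⟩ := h
  refine ⟨fun i j => Fin.lastCases (motive := fun _ => ℝ)
      (Fin.lastCases (motive := fun _ => ℝ) 1 (fun _ => 0) j)
      (fun i => Fin.lastCases (motive := fun _ => ℝ) 0 (fun j => L i j) j) i,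
    fun i j => Fin.lastCases (motive := fun _ => ℝ)
      (Fin.lastCases (motive := fun _ => ℝ) 1 (fun _ => 0) j)
      (fun i => Fin.lastCases (motive := fun _ => ℝ) 0 (fun j => U i j) j) i,
    fun i => Fin.lastCases (motive := fun _ => ℝ) 1 d i, ?_, ?_, ?_, ?_, ?_, ?_, ?_, ?_,
    k.castSucc, ?_⟩
  · intro i; induction i using Fin.lastCases <;> simp [h1]
  · intro i j hij
    induction i using Fin.lastCases with
    | last => exact absurd hij (not_lt.mpr (Fin.le_last j))
    | cast i =>
      induction j using Fin.lastCases with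
      | last => simp
      | cast j => simpa using h2 i j (by simpa using hij)
  · intro i j
    induction i using Fin.lastCases <;> induction j using Fin.lastCases <;> simp [h3]
  · intro i; induction i using Fin.lastCases <;> simp [h4]
  · intro i j hij
    induction j using Fin.lastCases with
    | last => exact absurd hij (not_lt.mpr (Fin.le_last i))
    | cast j =>
      induction i using Fin.lastCases with
      | last => simp
      | cast i => simpa using h5 i j (by simpa using hij)
  · intro i j
    induction i using Fin.lastCases <;> induction j using Fin.lastCases <;> simp [h6]
  · intro i; induction i using Fin.lastCases <;> simp [h7]
  · intro i j
    induction i using Fin.lastCases <;> induction j using Fin.lastCases <;>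
      simp [Fin.sum_univ_castSucc, h8]
  · simpa using hk

theorem good_mono {m n : ℕ} {c : ℝ} (h : Good m c) (hmn : m ≤ n) : Good n c := by
  induction n, hmn using Nat.le_induction with
  | base => exact h
  | succ n _ ih => exact good_succ ih

theorem lex_of_lt {m n : ℕ} {i j : Fin (m * n)} (h : i < j) :
    (finProdFinEquiv.symm i).1 < (finProdFinEquiv.symm j).1 ∨
    ((finProdFinEquiv.symm i).1 = (finProdFinEquiv.symm j).1 ∧
      (finProdFinEquiv.symm i).2 < (finProdFinEquiv.symm j).2) := by
  obtain ⟨⟨a, b⟩, rfl⟩ := finProdFinEquiv.surjective i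
  obtain ⟨⟨a', b'⟩, rfl⟩ := finProdFinEquiv.surjective j
  simp only [Equiv.symm_apply_apply]
  rw [Fin.lt_def] at h
  simp only [finProdFinEquiv_apply_val] at h
  rcases lt_trichotomy a a' with h1 | h1 | h1
  · exact Or.inl h1
  · subst h1
    right
    refine ⟨rfl, ?_⟩
    rw [Fin.lt_def]; omega
  · exfalso
    have h2 : n * (a'.1 + 1) ≤ n * a.1 := Nat.mul_le_mul_left _ h1
    have := b'.2
    rw [mul_add] at h2
    omega

theorem good_mul {m n : ℕ} {c c' : ℝ} (h : Good m c) (h' : Good n c') (hc : 0 ≤ c') :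
    Good (m * n) (c * c') := by
  obtain ⟨L, U, d, h1, h2, h3, h4, h5, h6, h7, h8, k, hk⟩ := h
  obtain ⟨L', U', d', h1', h2', h3', h4', h5', h6', h7', h8', k', hk'⟩ := h'
  let e : Fin (m * n) ≃ Fin m × Fin n := finProdFinEquiv.symm
  refine ⟨fun i j => L (e i).1 (e j).1 * L' (e i).2 (e j).2,
    fun i j => U (e i).1 (e j).1 * U' (e i).2 (e j).2,
    fun i => d (e i).1 * d' (e i).2, ?_, ?_, ?_, ?_, ?_, ?_, ?_, ?_, e.symm (k, k'), ?_⟩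
  · intro i; simp [h1, h1']
  · intro i j hij
    rcases lex_of_lt hij with h | ⟨_, h⟩
    · exact mul_eq_zero_of_left (h2 _ _ h) _
    · exact mul_eq_zero_of_right _ (h2' _ _ h)
  · intro i j
    rw [abs_mul]
    exact mul_le_one₀ (h3 _ _) (abs_nonneg _) (h3' _ _)
  · intro i; simp [h4, h4']
  · intro i j hij
    rcases lex_of_lt hij with h | ⟨_, h⟩
    · exact mul_eq_zero_of_left (h5 _ _ h) _
    · exact mul_eq_zero_of_right _ (h5' _ _ h)
  · intro i j
    rw [abs_mul]
    exact mul_le_one₀ (h6 _ _) (abs_nonneg _) (h6' _ _)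
  · intro i; exact mul_pos (h7 _) (h7' _)
  · intro i j
    have : ∑ x, L (e i).1 (e x).1 * L' (e i).2 (e x).2 * (d (e x).1 * d' (e x).2) *
        (U (e x).1 (e j).1 * U' (e x).2 (e j).2) =
        (∑ a, L (e i).1 a * d a * U a (e j).1) * (∑ b, L' (e i).2 b * d' b * U' b (e j).2) := by
      rw [Finset.sum_mul_sum, ← Fintype.sum_prod_type', ← e.sum_comp]
      exact Finset.sum_congr rfl fun x _ => by ring
    rw [this, abs_mul]
    exact mul_le_one₀ (h8 _ _) (abs_nonneg _) (h8' _ _)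
  · simp only [Equiv.apply_symm_apply]
    exact mul_le_mul hk hk' hc (h7 _).le

theorem good_pow {m : ℕ} {c : ℝ} (h : Good m c) (hc : 0 ≤ c) (k : ℕ) : Good (m ^ k) (c ^ k) := by
  induction k with
  | zero => simpa using good_one
  | succ k ih => rw [pow_succ, pow_succ]; exact good_mul ih h hc

theorem check_len : rowsL.length = 36 ∧ colsU.length = 36 ∧ pivD.length = 36 := by decide +kernel

theorem check_prod : ∀ r ∈ rowsL, ∀ s ∈ colsU,
    -100000000000 ≤ dot3 r pivD s ∧ dot3 r pivD s ≤ 100000000000 := by decide +kernel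

theorem check_tri : ∀ i < 36, (rowsL.getD i []).length = i + 1 ∧ (colsU.getD i []).length = i + 1 ∧
    (rowsL.getD i []).getD i 0 = 10000 ∧ (colsU.getD i []).getD i 0 = 10000 ∧
    0 < pivD.getD i 0 := by decide +kernel

theorem check_bd : (∀ r ∈ rowsL, ∀ x ∈ r, -10000 ≤ x ∧ x ≤ 10000) ∧
    (∀ r ∈ colsU, ∀ x ∈ r, -10000 ≤ x ∧ x ≤ 10000) := by decide +kernel

theorem getD_bd {l : List ℤ} (h : ∀ x ∈ l, -10000 ≤ x ∧ x ≤ 10000) (k : ℕ) :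
    |((l.getD k 0 : ℤ) : ℝ) / 10000| ≤ 1 := by
  have h2 : -10000 ≤ l.getD k 0 ∧ l.getD k 0 ≤ 10000 := by
    by_cases hk : k < l.length
    · rw [List.getD_eq_getElem _ _ hk]
      exact h _ (List.getElem_mem hk)
    · rw [List.getD_eq_default _ _ (by omega)]; norm_num
  rw [abs_le]
  have h3 : (-10000 : ℝ) ≤ (l.getD k 0 : ℤ) := by exact_mod_cast h2.1
  have h4 : ((l.getD k 0 : ℤ) : ℝ) ≤ 10000 := by exact_mod_cast h2.2
  constructor <;> linarith

theorem getD_mem' {l : List (List ℤ)} {k : ℕ} (h : k < l.length) : l.getD k [] ∈ l := by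
  rw [List.getD_eq_getElem _ _ h]; exact List.getElem_mem h

theorem good_base : Good 36 400 := by
  obtain ⟨hl1, hl2, hl3⟩ := check_len
  have mL : ∀ i : Fin 36, rowsL.getD i [] ∈ rowsL := fun i => getD_mem' (by omega)
  have mU : ∀ i : Fin 36, colsU.getD i [] ∈ colsU := fun i => getD_mem' (by omega)
  refine ⟨fun i j => (((rowsL.getD i []).getD j 0 : ℤ) : ℝ) / 10000,
    fun i j => (((colsU.getD j []).getD i 0 : ℤ) : ℝ) / 10000,
    fun i => ((pivD.getD i 0 : ℤ) : ℝ) / 1000, ?_, ?_, ?_, ?_, ?_, ?_, ?_, ?_, 35, ?_⟩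
  · intro i
    simp only [(check_tri i i.2).2.2.1]; norm_num
  · intro i j hij
    have := (check_tri i i.2).1
    simp only
    rw [List.getD_eq_default _ _ (by rw [this]; exact hij)]; simp
  · intro i j; exact getD_bd (check_bd.1 _ (mL i)) _
  · intro i
    simp only [(check_tri i i.2).2.2.2.1]; norm_num
  · intro i j hij
    have := (check_tri j j.2).2.1
    simp only
    rw [List.getD_eq_default _ _ (by rw [this]; exact hij)]; simp
  · intro i j; exact getD_bd (check_bd.2 _ (mU j)) _
  · intro k
    have : (0 : ℝ) < (pivD.getD k 0 : ℤ) := by exact_mod_cast (check_tri k k.2).2.2.2.2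
    positivity
  · intro i j
    have h := check_prod _ (mL i) _ (mU j)
    have e := dot3_eq 36 (rowsL.getD i []) pivD (colsU.getD j []) hl3
    have e2 : ∑ k : Fin 36, (((rowsL.getD i []).getD k 0 : ℤ) : ℝ) / 10000 *
        (((pivD.getD k 0 : ℤ) : ℝ) / 1000) * ((((colsU.getD j []).getD k 0 : ℤ) : ℝ) / 10000) =
        ((dot3 (rowsL.getD i []) pivD (colsU.getD j []) : ℤ) : ℝ) / 100000000000 := by
      rw [e, Finset.sum_range]
      push_cast
      rw [Finset.sum_div]
      exact Finset.sum_congr rfl fun x _ => by ring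
    rw [e2, abs_le]
    have h3 : (-100000000000 : ℝ) ≤ (dot3 (rowsL.getD i []) pivD (colsU.getD j []) : ℤ) := by
      exact_mod_cast h.1
    have h4 : ((dot3 (rowsL.getD i []) pivD (colsU.getD j []) : ℤ) : ℝ) ≤ 100000000000 := by
      exact_mod_cast h.2
    constructor <;> linarith
  · have : (400000 : ℤ) ≤ pivD.getD ((35 : Fin 36) : ℕ) 0 := by decide +kernel
    have h2 : (400000 : ℝ) ≤ (pivD.getD ((35 : Fin 36) : ℕ) 0 : ℤ) := by exact_mod_cast this
    linarith

/-- The maximum of the entries. -/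
noncomputable def mxE {n : ℕ} (A : Matrix (Fin n) (Fin n) ℝ) : ℝ := ⨆ i : Fin n, ⨆ j : Fin n, ‖A i j‖

theorem le_mxE {n : ℕ} (A : Matrix (Fin n) (Fin n) ℝ) (i j : Fin n) : ‖A i j‖ ≤ mxE A :=
  (le_ciSup (f := fun j => ‖A i j‖) (Set.finite_range _).bddAbove j).trans
    (le_ciSup (f := fun i => ⨆ j, ‖A i j‖) (Set.finite_range _).bddAbove i)

theorem mxE_nonneg {n : ℕ} (A : Matrix (Fin n) (Fin n) ℝ) : 0 ≤ mxE A :=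
  Real.iSup_nonneg fun _ => Real.iSup_nonneg fun _ => norm_nonneg _

theorem geIter_succ_apply {n : ℕ} {A : Matrix (Fin n) (Fin n) ℝ} {k : ℕ} {i j : Fin n} (hk : k < n)
    (hi : k + 1 ≤ i.1) (hj : k + 1 ≤ j.1) : geIter A (k + 1) i j = geIter A k i j -
      geIter A k i ⟨k, hk⟩ * geIter A k ⟨k, hk⟩ j / geIter A k ⟨k, hk⟩ ⟨k, hk⟩ :=
  dif_pos (⟨hk, hi, hj⟩ : k < n ∧ k + 1 ≤ i.1 ∧ k + 1 ≤ j.1)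

theorem geIter_bound {n : ℕ} {A : Matrix (Fin n) (Fin n) ℝ} (hA : IsRP A) (k : ℕ) :
    ∀ i j : Fin n, k ≤ i.1 → k ≤ j.1 → ‖geIter A k i j‖ ≤ 2 ^ k * mxE A := by
  induction k with
  | zero => intro i j _ _; simpa [geIter] using le_mxE A i j
  | succ k ih =>
    intro i j hi hj
    have hk : k < n := by omega
    rw [geIter_succ_apply hk hi hj]
    have h1 := ih i j (by omega) (by omega)
    have h2 := ih ⟨k, hk⟩ j le_rfl (by omega)
    have h3 := (hA.2.2 k hk i (by omega)).1
    rw [pivotNorm, dif_pos hk] at h3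
    have h4 : ‖geIter A k i ⟨k, hk⟩ * geIter A k ⟨k, hk⟩ j / geIter A k ⟨k, hk⟩ ⟨k, hk⟩‖ ≤
        ‖geIter A k ⟨k, hk⟩ j‖ := by
      rw [norm_div, norm_mul]
      apply div_le_of_le_mul₀ (norm_nonneg _) (norm_nonneg _)
      rw [mul_comm]
      exact mul_le_mul_of_nonneg_left h3 (norm_nonneg _)
    have h5 := norm_sub_le (geIter A k i j)
      (geIter A k i ⟨k, hk⟩ * geIter A k ⟨k, hk⟩ j / geIter A k ⟨k, hk⟩ ⟨k, hk⟩)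
    rw [pow_succ]
    linarith

theorem growth_bdd (n : ℕ) :
    BddAbove (growth '' {A : Matrix (Fin n) (Fin n) ℝ | IsRP A}) := by
  refine ⟨2 ^ n, ?_⟩
  rintro _ ⟨A, hA, rfl⟩
  unfold growth
  have h0 := mxE_nonneg A
  apply div_le_of_le_mul₀ h0 (by positivity)
  have hp : 0 ≤ 2 ^ n * mxE A := by positivity
  refine Real.iSup_le (fun k => Real.iSup_le (fun i => Real.iSup_le (fun j => ?_) hp) hp) hp
  split_ifs with h
  · refine (geIter_bound hA k i j h.1 h.2).trans ?_
    have : (2 : ℝ) ^ k.1 ≤ 2 ^ n := pow_le_pow_right₀ (by norm_num) k.2.le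
    exact mul_le_mul_of_nonneg_right this h0
  · exact hp

theorem le_growth {n : ℕ} (A : Matrix (Fin n) (Fin n) ℝ) (k i j : Fin n) (hi : k.1 ≤ i.1)
    (hj : k.1 ≤ j.1) (h1 : mxE A ≤ 1) (h0 : 0 < mxE A) : ‖geIter A k.1 i j‖ ≤ growth A := by
  have h : ‖geIter A k.1 i j‖ ≤ ⨆ k : Fin n, ⨆ i : Fin n, ⨆ j : Fin n,
      if k.1 ≤ i.1 ∧ k.1 ≤ j.1 then ‖geIter A k.1 i j‖ else 0 := by
    refine le_trans ?_ (le_ciSup (Set.finite_range _).bddAbove k)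
    refine le_trans ?_ (le_ciSup (Set.finite_range _).bddAbove i)
    refine le_trans ?_ (le_ciSup (Set.finite_range _).bddAbove j)
    rw [if_pos ⟨hi, hj⟩]
  unfold growth
  change _ ≤ _ / mxE A
  rw [le_div_iff₀ h0]
  have := norm_nonneg (geIter A k.1 i j)
  nlinarith

theorem geIter_LDU {n : ℕ} {L U : Fin n → Fin n → ℝ} {d : Fin n → ℝ}
    (h1 : ∀ i, L i i = 1) (h2 : ∀ i j, i < j → L i j = 0)
    (h4 : ∀ i, U i i = 1) (h5 : ∀ i j, j < i → U i j = 0) (h7 : ∀ k, 0 < d k) (k : ℕ) :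
    ∀ i j : Fin n, k ≤ i.1 → k ≤ j.1 → geIter (Matrix.of fun i j => ∑ k, L i k * d k * U k j) k i j =
      ∑ m, if k ≤ m.1 then L i m * d m * U m j else 0 := by
  induction k with
  | zero => intro i j _ _; simp [geIter]
  | succ k ih =>
    intro i j hi hj
    have hk : k < n := by omega
    rw [geIter_succ_apply hk hi hj]
    rw [ih i j (by omega) (by omega), ih i ⟨k, hk⟩ (by omega) le_rfl,
      ih ⟨k, hk⟩ j le_rfl (by omega), ih ⟨k, hk⟩ ⟨k, hk⟩ le_rfl le_rfl]
    have e1 : ∀ i, (∑ m : Fin n, if k ≤ m.1 then L i m * d m * U m ⟨k, hk⟩ else 0) =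
        L i ⟨k, hk⟩ * d ⟨k, hk⟩ := by
      intro i
      rw [Finset.sum_eq_single ⟨k, hk⟩]
      · simp [h4]
      · intro m _ hm
        split_ifs with hkm
        · rw [h5 m ⟨k, hk⟩ (lt_of_le_of_ne hkm (Ne.symm hm)), mul_zero]
        · rfl
      · simp
    have e2 : ∀ j, (∑ m : Fin n, if k ≤ m.1 then L ⟨k, hk⟩ m * d m * U m j else 0) =
        d ⟨k, hk⟩ * U ⟨k, hk⟩ j := by
      intro j
      rw [Finset.sum_eq_single ⟨k, hk⟩]
      · simp [h1]
      · intro m _ hm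
        split_ifs with hkm
        · rw [h2 ⟨k, hk⟩ m (lt_of_le_of_ne hkm (Ne.symm hm)), zero_mul, zero_mul]
        · rfl
      · simp
    rw [e1, e1, e2, h1, one_mul]
    have hd := (h7 ⟨k, hk⟩).ne'
    have e3 : L i ⟨k, hk⟩ * d ⟨k, hk⟩ * (d ⟨k, hk⟩ * U ⟨k, hk⟩ j) / d ⟨k, hk⟩ =
        ∑ m : Fin n, if m = ⟨k, hk⟩ then L i m * d m * U m j else 0 := by
      rw [Finset.sum_ite_eq' Finset.univ]
      simp only [Finset.mem_univ, if_true]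
      field_simp
    rw [e3, ← Finset.sum_sub_distrib]
    refine Finset.sum_congr rfl fun m _ => ?_
    by_cases hm : m = ⟨k, hk⟩
    · subst hm; simp
    · have : m.1 ≠ k := fun h => hm (Fin.ext h)
      by_cases h : k ≤ m.1
      · rw [if_pos h, if_neg hm, if_pos (by omega), sub_zero]
      · rw [if_neg h, if_neg hm, if_neg (by omega), sub_zero]

theorem good_le_gRP {n : ℕ} {c : ℝ} (h : Good n c) : c ≤ gRP ℝ n := by
  obtain ⟨L, U, d, h1, h2, h3, h4, h5, h6, h7, h8, k, hk⟩ := h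
  let A : Matrix (Fin n) (Fin n) ℝ := Matrix.of fun i j => ∑ k, L i k * d k * U k j
  have hg := geIter_LDU (d := d) h1 h2 h4 h5 h7
  have gcol : ∀ (k : ℕ) (hk : k < n) (i : Fin n), k ≤ i.1 →
      geIter A k i ⟨k, hk⟩ = L i ⟨k, hk⟩ * d ⟨k, hk⟩ := by
    intro k hk i hi
    rw [hg k i ⟨k, hk⟩ hi le_rfl, Finset.sum_eq_single ⟨k, hk⟩]
    · simp [h4]
    · intro m _ hm
      split_ifs with hkm
      · rw [h5 m ⟨k, hk⟩ (lt_of_le_of_ne hkm (Ne.symm hm)), mul_zero]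
      · rfl
    · simp
  have grow : ∀ (k : ℕ) (hk : k < n) (i : Fin n), k ≤ i.1 →
      geIter A k ⟨k, hk⟩ i = d ⟨k, hk⟩ * U ⟨k, hk⟩ i := by
    intro k hk i hi
    rw [hg k ⟨k, hk⟩ i le_rfl hi, Finset.sum_eq_single ⟨k, hk⟩]
    · simp [h1]
    · intro m _ hm
      split_ifs with hkm
      · rw [h2 ⟨k, hk⟩ m (lt_of_le_of_ne hkm (Ne.symm hm)), zero_mul, zero_mul]
      · rfl
    · simp
  have hp : ∀ (k : ℕ) (hk : k < n), pivotNorm A k = d ⟨k, hk⟩ := by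
    intro k hk
    rw [pivotNorm, dif_pos hk, gcol k hk ⟨k, hk⟩ le_rfl, h1, one_mul, Real.norm_eq_abs,
      abs_of_pos (h7 _)]
  have hdet : A.det ≠ 0 := by
    have e : A = Matrix.of L * Matrix.diagonal d * Matrix.of U := by
      ext i j
      rw [Matrix.mul_apply]
      change ∑ k, L i k * d k * U k j = _
      exact Finset.sum_congr rfl fun x _ => by rw [Matrix.mul_diagonal]; rfl
    have dL : (Matrix.of L).det = 1 := by
      rw [Matrix.det_of_isLowerTriangular (M := Matrix.of L) (fun i j hij => h2 i j hij)]
      simp [h1]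
    have dU : (Matrix.of U).det = 1 := by
      rw [Matrix.det_of_isUpperTriangular (M := Matrix.of U) (fun i j hij => h5 i j hij)]
      simp [h4]
    rw [e, Matrix.det_mul, Matrix.det_mul, dL, dU, Matrix.det_diagonal, one_mul, mul_one]
    exact Finset.prod_ne_zero_iff.mpr fun i _ => (h7 i).ne'
  have hRP : IsRP A := by
    refine ⟨hdet, fun k hk => ?_, fun k hk i hi => ?_⟩
    · rw [hp k (by omega)]; exact (h7 _).ne'
    · rw [hp k hk, gcol k hk i hi, grow k hk i hi, norm_mul, norm_mul, Real.norm_eq_abs,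
        Real.norm_eq_abs, Real.norm_eq_abs, abs_of_pos (h7 _)]
      have hd := h7 ⟨k, hk⟩
      exact ⟨mul_le_of_le_one_left hd.le (h3 _ _), mul_le_of_le_one_right hd.le (h6 _ _)⟩
  have hm1 : mxE A ≤ 1 :=
    Real.iSup_le (fun i => Real.iSup_le (fun j => h8 i j) zero_le_one) zero_le_one
  have hm0 : 0 < mxE A := by
    have hn : 0 < n := k.pos
    have := le_mxE A ⟨0, hn⟩ ⟨0, hn⟩
    have h00 : A ⟨0, hn⟩ ⟨0, hn⟩ = d ⟨0, hn⟩ := by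
      have := gcol 0 hn ⟨0, hn⟩ le_rfl
      rw [h1, one_mul] at this
      exact this
    rw [h00, Real.norm_eq_abs, abs_of_pos (h7 _)] at this
    exact (h7 _).trans_le this
  have hl := le_growth A k k k le_rfl le_rfl hm1 hm0
  have hpk := hp k.1 k.2
  rw [pivotNorm, dif_pos k.2] at hpk
  calc c ≤ d k := hk
    _ = ‖geIter A k.1 k k‖ := hpk.symm
    _ ≤ growth A := hl
    _ ≤ gRP ℝ n := le_csSup (growth_bdd n) ⟨A, hRP, rfl⟩

theorem rpow_num : (36 : ℝ) ^ (1.669 : ℝ) ≤ 400 := by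
  have h1 : (36 : ℝ) ^ (1.669 : ℝ) ≤ 36 ^ (167 / 100 : ℝ) :=
    Real.rpow_le_rpow_of_exponent_le (by norm_num) (by norm_num)
  refine h1.trans ?_
  have h2 : ((36 : ℝ) ^ (167 / 100 : ℝ)) ^ 100 ≤ 400 ^ 100 := by
    rw [← Real.rpow_natCast, ← Real.rpow_mul (by norm_num)]
    have : (167 / 100 : ℝ) * ((100 : ℕ) : ℝ) = ((167 : ℕ) : ℝ) := by norm_num
    rw [this, Real.rpow_natCast]
    norm_num
  exact le_of_pow_le_pow_left₀ (by norm_num) (by norm_num) h2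

/-- `g[RP_n(ℝ)] > (1/641) · n^{1.669}` for every `n ≥ 1`. -/
theorem rook_growth_lower_bound (n : ℕ) (hn : 1 ≤ n) :
    (1 / 641 : ℝ) * (n : ℝ) ^ (1.669 : ℝ) < gRP ℝ n := by
  set k := Nat.log 36 n with hk
  have h1 : 36 ^ k ≤ n := Nat.pow_log_le_self 36 (by omega)
  have h2 : n < 36 ^ (k + 1) := Nat.lt_pow_succ_log_self (by norm_num) n
  have h3 := good_le_gRP (good_mono (good_pow good_base (by norm_num) k) h1)
  have h4 : (n : ℝ) ^ (1.669 : ℝ) ≤ 400 ^ (k + 1) := by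
    calc (n : ℝ) ^ (1.669 : ℝ) ≤ ((36 : ℝ) ^ (k + 1)) ^ (1.669 : ℝ) := by
          apply Real.rpow_le_rpow (by positivity) _ (by norm_num)
          exact_mod_cast h2.le
      _ = ((36 : ℝ) ^ (1.669 : ℝ)) ^ (k + 1) := by
          rw [← Real.rpow_natCast, ← Real.rpow_natCast, ← Real.rpow_mul (by norm_num),
            ← Real.rpow_mul (by norm_num), mul_comm]
      _ ≤ 400 ^ (k + 1) := pow_le_pow_left₀ (by positivity) rpow_num _
  have h5 : (0 : ℝ) < 400 ^ k := by positivity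
  rw [pow_succ] at h4
  linarith
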